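/- The Lance–Williams method fixes ultrametrics: suppose that at every step the parameters satisfy α_I, α_J ≥ 0, α_I + α_J = 1, β = 0 and |γ| ≤ min(α_I, α_J). If the input d_H is a pseudo-ultrametric, then τ(d_H) = d_H. -/

import Mathlib

open MeasureTheory ProbabilityTheory Filter Matrix
open scoped RealInnerProductSpace

noncomputable section

/-- Parameters of the Lance–Williams update rule, as functions of the cluster
sizes `n_I`, `n_J`, `n_K`. -/
structure LWParams where
  αI : ℕ → ℕ → ℕ → ℝ
  αJ : ℕ → ℕ → ℕ → ℝ
  β  : ℕ → ℕ → ℕ → ℝ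
  γ  : ℕ → ℕ → ℕ → ℝ

/-- State of the Lance–Williams algorithm: current list of clusters, current
inter-cluster distance, and the output matrix recorded so far. -/
structure LWState (M : ℕ) where
  clusters : List (Finset (Fin M))
  dist : Finset (Fin M) → Finset (Fin M) → ℝ
  out : Fin M → Fin M → ℝ

/-- All unordered pairs of elements of a list (each pair listed once, in list order). -/
def pairsOf {α : Type*} : List α → List (α × α)
  | [] => []
  | a :: l => (l.map fun b => (a, b)) ++ pairsOf l

/-- One merge step of the Lance–Williams algorithm: pick the (first) pair of clusters at
minimal distance, record the merge height into the output matrix, and update the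
inter-cluster distances by the Lance–Williams formula. -/
def lwStep {M : ℕ} (p : LWParams) (s : LWState M) : LWState M :=
  match (pairsOf s.clusters).argmin (fun q => s.dist q.1 q.2) with
  | none => s
  | some q =>
    let I := q.1
    let J := q.2
    { clusters := (I ∪ J) :: ((s.clusters.erase I).erase J)
      dist := fun A B =>
        if A = I ∪ J ∧ B = I ∪ J then 0
        else if A = I ∪ J then
          p.αI I.card J.card B.card * s.dist I B + p.αJ I.card J.card B.card * s.dist J B +
            p.β I.card J.card B.card * s.dist I J +
            p.γ I.card J.card B.card * |s.dist I B - s.dist J B|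
        else if B = I ∪ J then
          p.αI I.card J.card A.card * s.dist I A + p.αJ I.card J.card A.card * s.dist J A +
            p.β I.card J.card A.card * s.dist I J +
            p.γ I.card J.card A.card * |s.dist I A - s.dist J A|
        else s.dist A B
      out := fun i j => if (i ∈ I ∧ j ∈ J) ∨ (i ∈ J ∧ j ∈ I) then s.dist I J else s.out i j }

/-- Initial state: singletons, with the input dissimilarity. -/
def lwInit (M : ℕ) (dH : Fin M → Fin M → ℝ) : LWState M :=
  { clusters := (List.finRange M).map fun i => {i}
    dist := fun A B => ∑ i ∈ A, ∑ j ∈ B, dH i j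
    out := dH }

/-- The state after running all `M - 1` merge steps. -/
def lwRun (M : ℕ) (p : LWParams) (dH : Fin M → Fin M → ℝ) : LWState M :=
  (lwStep p)^[M - 1] (lwInit M dH)

/-- The Lance–Williams map `τ`: the output matrix `d_T` of the algorithm. -/
def lwTau (M : ℕ) (p : LWParams) (dH : Fin M → Fin M → ℝ) : Fin M → Fin M → ℝ :=
  fun i j => if i = j then 0 else (lwRun M p dH).out i j

/-- The algorithm run on `dH` has a strictly unique minimizing pair at every merge step. -/
def lwNoTies (M : ℕ) (p : LWParams) (dH : Fin M → Fin M → ℝ) : Prop :=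
  ∀ k < M - 1,
    ∃ q ∈ pairsOf ((lwStep p)^[k] (lwInit M dH)).clusters,
      ∀ r ∈ pairsOf ((lwStep p)^[k] (lwInit M dH)).clusters, r ≠ q →
        ((lwStep p)^[k] (lwInit M dH)).dist q.1 q.2 < ((lwStep p)^[k] (lwInit M dH)).dist r.1 r.2

/-- `dH` is a symmetric nonnegative matrix with zero diagonal. -/
def IsDissim (M : ℕ) (dH : Fin M → Fin M → ℝ) : Prop :=
  (∀ i j, 0 ≤ dH i j) ∧ (∀ i, dH i i = 0) ∧ (∀ i j, dH i j = dH j i)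

/-- The parameter conditions `α_I, α_J ≥ 0`, `α_I + α_J = 1`, `β = 0`,
`|γ| ≤ min(α_I, α_J)` at every step. -/
def LWConvexParams (p : LWParams) : Prop :=
  ∀ nI nJ nK, 0 ≤ p.αI nI nJ nK ∧ 0 ≤ p.αJ nI nJ nK ∧
    p.αI nI nJ nK + p.αJ nI nJ nK = 1 ∧ p.β nI nJ nK = 0 ∧
    |p.γ nI nJ nK| ≤ min (p.αI nI nJ nK) (p.αJ nI nJ nK)

/-- A pseudo-ultrametric: symmetric, nonnegative, zero diagonal, and
`u(i,k) ≤ max (u(i,j)) (u(j,k))`. -/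
def IsPseudoUltrametric (M : ℕ) (u : Fin M → Fin M → ℝ) : Prop :=
  (∀ i j, 0 ≤ u i j) ∧ (∀ i, u i i = 0) ∧ (∀ i j, u i j = u j i) ∧
    ∀ i j k, u i k ≤ max (u i j) (u j k)

theorem rel_of_mem_pairsOf {α : Type*} {R : α → α → Prop} {l : List α} (hl : l.Pairwise R)
    {q : α × α} (hq : q ∈ pairsOf l) : q.1 ∈ l ∧ q.2 ∈ l ∧ R q.1 q.2 := by
  induction l with
  | nil => simp [pairsOf] at hq
  | cons a l ih =>
    rw [List.pairwise_cons] at hl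
    simp only [pairsOf, List.mem_append, List.mem_map] at hq
    rcases hq with ⟨b, hb, rfl⟩ | hq
    · exact ⟨List.mem_cons_self, List.mem_cons_of_mem _ hb, hl.1 b hb⟩
    · obtain ⟨h₁, h₂, h₃⟩ := ih hl.2 hq
      exact ⟨List.mem_cons_of_mem _ h₁, List.mem_cons_of_mem _ h₂, h₃⟩

theorem mem_pairsOf_or_swap_mem {α : Type*} {l : List α} {a b : α} (ha : a ∈ l) (hb : b ∈ l)
    (hab : a ≠ b) : (a, b) ∈ pairsOf l ∨ (b, a) ∈ pairsOf l := by
  induction l with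
  | nil => simp at ha
  | cons c l ih =>
    simp only [pairsOf, List.mem_append, List.mem_map, Prod.mk.injEq]
    rw [List.mem_cons] at ha hb
    rcases ha with rfl | ha <;> rcases hb with rfl | hb
    · exact absurd rfl hab
    · exact Or.inl (Or.inl ⟨b, hb, rfl, rfl⟩)
    · exact Or.inr (Or.inl ⟨a, ha, rfl, rfl⟩)
    · exact (ih ha hb).imp Or.inr Or.inr

/-- In a pseudo-ultrametric, if `u i j` is the smallest side of a triangle, then the other two
sides agree. -/
theorem IsPseudoUltrametric.eq_of_le {M : ℕ} {u : Fin M → Fin M → ℝ}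
    (hu : IsPseudoUltrametric M u) {i j k : Fin M} (hi : u i j ≤ u i k) (hj : u i j ≤ u j k) :
    u i k = u j k := by
  obtain ⟨-, -, hsymm, htri⟩ := hu
  have h₁ := htri i j k
  have h₂ := htri j i k
  rw [max_eq_right hj] at h₁
  rw [hsymm j i, max_eq_right hi] at h₂
  exact le_antisymm h₁ h₂

/-- The clusters are nonempty and pairwise disjoint, the inter-cluster distances are the values
of `u` between arbitrary representatives, and the recorded output is `u`. -/
structure LWState.Represents {M : ℕ} (s : LWState M) (u : Fin M → Fin M → ℝ) : Prop where
  nonempty : ∀ A ∈ s.clusters, A.Nonempty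
  disjoint : s.clusters.Pairwise Disjoint
  dist_eq : ∀ A ∈ s.clusters, ∀ B ∈ s.clusters, A ≠ B → ∀ i ∈ A, ∀ j ∈ B, s.dist A B = u i j
  out_eq : s.out = u

namespace LWState.Represents

variable {M : ℕ} {s : LWState M} {u : Fin M → Fin M → ℝ}

theorem nodup (h : s.Represents u) : s.clusters.Nodup :=
  h.disjoint.imp_of_mem fun {_ _} ha _ hab =>
    hab.ne (h.nonempty _ ha).ne_empty

theorem disjoint_of_ne (h : s.Represents u) {A B : Finset (Fin M)} (hA : A ∈ s.clusters)
    (hB : B ∈ s.clusters) (hAB : A ≠ B) : Disjoint A B :=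
  (mem_pairsOf_or_swap_mem hA hB hAB).elim
    (fun hm => (rel_of_mem_pairsOf h.disjoint hm).2.2)
    (fun hm => (rel_of_mem_pairsOf h.disjoint hm).2.2.symm)

theorem dist_comm (h : s.Represents u) (hu : IsPseudoUltrametric M u) {A B : Finset (Fin M)}
    (hA : A ∈ s.clusters) (hB : B ∈ s.clusters) : s.dist A B = s.dist B A := by
  rcases eq_or_ne A B with rfl | hne
  · rfl
  obtain ⟨i, hi⟩ := h.nonempty A hA
  obtain ⟨j, hj⟩ := h.nonempty B hB
  rw [h.dist_eq A hA B hB hne i hi j hj, h.dist_eq B hB A hA hne.symm j hj i hi, hu.2.2.1]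

theorem lwStep (h : s.Represents u) (hu : IsPseudoUltrametric M u) {p : LWParams}
    (hp : LWConvexParams p) : (lwStep p s).Represents u := by
  unfold _root_.lwStep
  split
  · exact h
  rename_i q hq
  obtain ⟨I, J⟩ := q
  have hmem := List.argmin_mem hq
  obtain ⟨hI, hJ, hIJd⟩ := rel_of_mem_pairsOf h.disjoint hmem
  obtain ⟨-, -, hIJ⟩ := rel_of_mem_pairsOf h.nodup hmem
  have hmin : ∀ A ∈ s.clusters, ∀ B ∈ s.clusters, A ≠ B → s.dist I J ≤ s.dist A B := by
    intro A hA B hB hAB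
    rcases mem_pairsOf_or_swap_mem hA hB hAB with hm | hm
    · exact List.le_of_mem_argmin hm hq
    · rw [h.dist_comm hu hA hB]
      exact List.le_of_mem_argmin hm hq
  dsimp only at hI hJ hIJ hIJd ⊢
  have hrest : ∀ K, K ∈ (s.clusters.erase I).erase J ↔ K ≠ J ∧ K ≠ I ∧ K ∈ s.clusters := by
    intro K
    rw [(h.nodup.erase I).mem_erase_iff, h.nodup.mem_erase_iff]
  have hdisj : ∀ K ∈ (s.clusters.erase I).erase J, Disjoint (I ∪ J) K := by
    intro K hK
    obtain ⟨hKJ, hKI, hK⟩ := (hrest K).1 hK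
    exact Finset.disjoint_union_left.2
      ⟨h.disjoint_of_ne hI hK hKI.symm, h.disjoint_of_ne hJ hK hKJ.symm⟩
  have hne : ∀ K ∈ (s.clusters.erase I).erase J, K ≠ I ∪ J := by
    intro K hK
    exact ((hdisj K hK).symm).ne (h.nonempty K ((hrest K).1 hK).2.2).ne_empty
  have hdist : ∀ K ∈ (s.clusters.erase I).erase J,
      s.dist I K = s.dist J K ∧ ∀ i ∈ I ∪ J, ∀ k ∈ K, s.dist J K = u i k := by
    intro K hK
    obtain ⟨hKJ, hKI, hK⟩ := (hrest K).1 hK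
    have heq : s.dist I K = s.dist J K := by
      obtain ⟨i, hi⟩ := h.nonempty I hI
      obtain ⟨j, hj⟩ := h.nonempty J hJ
      obtain ⟨k, hk⟩ := h.nonempty K hK
      have h₁ := hmin I hI K hK hKI.symm
      have h₂ := hmin J hJ K hK hKJ.symm
      rw [h.dist_eq I hI J hJ hIJ i hi j hj] at h₁ h₂
      rw [h.dist_eq I hI K hK hKI.symm i hi k hk] at h₁ ⊢
      rw [h.dist_eq J hJ K hK hKJ.symm j hj k hk] at h₂ ⊢
      exact hu.eq_of_le h₁ h₂
    refine ⟨heq, fun i hi k hk => ?_⟩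
    rcases Finset.mem_union.1 hi with hi | hi
    · rw [← heq]
      exact h.dist_eq I hI K hK hKI.symm i hi k hk
    · exact h.dist_eq J hJ K hK hKJ.symm i hi k hk
  have hupdate : ∀ K ∈ (s.clusters.erase I).erase J,
      p.αI I.card J.card K.card * s.dist I K + p.αJ I.card J.card K.card * s.dist J K +
        p.β I.card J.card K.card * s.dist I J +
        p.γ I.card J.card K.card * |s.dist I K - s.dist J K| = s.dist J K := by
    intro K hK
    obtain ⟨-, -, hα, hβ, -⟩ := hp I.card J.card K.card
    rw [(hdist K hK).1, hβ, sub_self, abs_zero, zero_mul, mul_zero, add_zero, add_zero,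
      ← add_mul, hα, one_mul]
  refine ⟨?_, ?_, ?_, ?_⟩
  · intro A hA
    rcases List.mem_cons.1 hA with rfl | hA
    · exact (h.nonempty I hI).mono Finset.subset_union_left
    · exact h.nonempty A ((hrest A).1 hA).2.2
  · exact List.pairwise_cons.2 ⟨hdisj,
      h.disjoint.sublist (List.erase_sublist.trans List.erase_sublist)⟩
  · intro A hA B hB hAB i hi j hj
    dsimp only
    rcases List.mem_cons.1 hA with rfl | hA <;> rcases List.mem_cons.1 hB with rfl | hB
    · exact absurd rfl hAB
    · rw [if_neg fun hc => hAB hc.2.symm, if_pos rfl, hupdate B hB]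
      exact (hdist B hB).2 i hi j hj
    · rw [if_neg fun hc => hAB hc.1, if_neg hAB, if_pos rfl, hupdate A hA, hu.2.2.1]
      exact (hdist A hA).2 j hj i hi
    · rw [if_neg fun hc => hne A hA hc.1, if_neg (hne A hA), if_neg (hne B hB)]
      exact h.dist_eq A ((hrest A).1 hA).2.2 B ((hrest B).1 hB).2.2 hAB i hi j hj
  · funext i j
    dsimp only
    split_ifs with hij
    · rcases hij with ⟨hi, hj⟩ | ⟨hi, hj⟩
      · exact h.dist_eq I hI J hJ hIJ i hi j hj
      · rw [hu.2.2.1]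
        exact h.dist_eq I hI J hJ hIJ j hj i hi
    · rw [h.out_eq]

end LWState.Represents

theorem represents_lwInit (M : ℕ) (dH : Fin M → Fin M → ℝ) : (lwInit M dH).Represents dH where
  nonempty := by
    intro A hA
    obtain ⟨i, -, rfl⟩ := List.mem_map.1 hA
    exact Finset.singleton_nonempty i
  disjoint := List.pairwise_map.2 <|
    (List.nodup_finRange M).imp fun hij => Finset.disjoint_singleton.2 hij
  dist_eq := by
    intro A hA B hB _ i hi j hj
    obtain ⟨a, -, rfl⟩ := List.mem_map.1 hA
    obtain ⟨b, -, rfl⟩ := List.mem_map.1 hB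
    obtain rfl := Finset.mem_singleton.1 hi
    obtain rfl := Finset.mem_singleton.1 hj
    simp [lwInit]
  out_eq := rfl

/-- The Lance–Williams method fixes ultrametrics: under the parameter conditions
`α_I, α_J ≥ 0`, `α_I + α_J = 1`, `β = 0`, `|γ| ≤ min(α_I, α_J)`, if the input `d_H` is a
pseudo-ultrametric then `τ(d_H) = d_H`. -/
theorem lanceWilliams_fixes_ultrametric (M : ℕ) (p : LWParams) (hp : LWConvexParams p)
    (dH : Fin M → Fin M → ℝ) (hdH : IsPseudoUltrametric M dH) :
    lwTau M p dH = dH := by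
  have hrun : ∀ k, ((lwStep p)^[k] (lwInit M dH)).Represents dH := by
    intro k
    induction k with
    | zero => exact represents_lwInit M dH
    | succ k ih =>
      rw [Function.iterate_succ_apply']
      exact ih.lwStep hdH hp
  funext i j
  unfold lwTau lwRun
  split_ifs with hij
  · rw [hij, hdH.2.1]
  · rw [(hrun (M - 1)).out_eq]
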